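/- arXiv:2102.02172 — 3 statements merged into one kernel-verified Lean document; each statement's English description precedes it below -/
import Mathlib

section
/- Let c ∈ ℝ⁴ with c₁ + c₂ > 0 and c₃ = c₄, and let s ∈ ℂ⁴ with Re(s₃) + Re(s₄) > 0. Then Σ'_{w ∈ W₂} exp(−⟨w·c, s⟩) = exp(−⟨c,s⟩)·θ₀₀( (c₁+c₂)(s₃−s₄)/(2πi), −(c₁+c₂)(s₃+s₄)/(πi) ), and Σ'_{w ∈ W₂} det(w)·exp(−⟨w·c, s⟩) = exp(−⟨c,s⟩)·θ₀₁( (c₁+c₂)(s₃−s₄)/(2πi), −(c₁+c₂)(s₃+s₄)/(πi) ). -/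
open Finset Complex

noncomputable section

/-- The Apollonian reflection as a linear map: it replaces the `i`-th coordinate `xᵢ`
by `2(Σ_{j≠i} xⱼ) − xᵢ = 2(Σ_j xⱼ) − 3xᵢ` and fixes the other coordinates. -/
def sigmaL (i : Fin 4) : (Fin 4 → ℝ) →ₗ[ℝ] (Fin 4 → ℝ) where
  toFun x := Function.update x i (2 * (∑ j, x j) - 3 * x i)
  map_add' x y := by
    funext j
    rcases eq_or_ne j i with h | h
    · subst h; simp [Function.update_self, Finset.sum_add_distrib]; ring
    · simp [Function.update_of_ne h]
  map_smul' r x := by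
    funext j
    rcases eq_or_ne j i with h | h
    · subst h
      simp only [Pi.smul_apply, smul_eq_mul, Function.update_self, RingHom.id_apply]
      rw [← Finset.mul_sum]
      ring
    · simp [Function.update_of_ne h]

lemma sigmaL_invol (i : Fin 4) : Function.Involutive (sigmaL i) := by
  intro x
  funext j
  have hsum : ∑ k, Function.update x i (2 * (∑ j, x j) - 3 * x i) k
      = 3 * (∑ k, x k) - 4 * x i := by
    rw [Finset.sum_update_of_mem (Finset.mem_univ i)]
    have : ∑ k ∈ Finset.univ \ {i}, x k = (∑ k, x k) - x i := by
      rw [Finset.sum_sdiff_eq_sub (Finset.subset_univ _), Finset.sum_singleton]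
    rw [this]; ring
  rcases eq_or_ne j i with h | h
  · subst h
    simp only [sigmaL, LinearMap.coe_mk, AddHom.coe_mk, Function.update_self, hsum]
    ring
  · simp [sigmaL, Function.update_of_ne h]

/-- The Apollonian reflection `σᵢ` as a linear automorphism of `ℝ⁴`. -/
def apSigma (i : Fin 4) : (Fin 4 → ℝ) ≃ₗ[ℝ] (Fin 4 → ℝ) :=
  LinearEquiv.ofInvolutive (sigmaL i) (sigmaL_invol i)

/-- The subgroup `W₂ = ⟨σ₃, σ₄⟩`. -/
def apW2 : Subgroup ((Fin 4 → ℝ) ≃ₗ[ℝ] (Fin 4 → ℝ)) :=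
  Subgroup.closure {apSigma 2, apSigma 3}

/-- The pairing `⟨x,s⟩ = x₁s₁+x₂s₂+x₃s₃+x₄s₄` of a real vector with a complex vector. -/
def pairC (x : Fin 4 → ℝ) (s : Fin 4 → ℂ) : ℂ := ∑ i, (x i : ℂ) * s i

/-- The Jacobi theta function `θ₀₁(z,τ) = Σ_{n∈ℤ} (−1)ⁿ exp(2πinz + πin²τ) = θ₀₀(z+1/2, τ)`. -/
def theta01 (z τ : ℂ) : ℂ := jacobiTheta₂ (z + 1/2) τ


lemma apSigma_mul_self (i : Fin 4) : apSigma i * apSigma i = 1 := by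
  ext1 x
  exact sigmaL_invol i x

lemma apSigma_inv (i : Fin 4) : (apSigma i)⁻¹ = apSigma i :=
  inv_eq_of_mul_eq_one_left (apSigma_mul_self i)

/-- The translation element. -/
def apT : (Fin 4 → ℝ) ≃ₗ[ℝ] (Fin 4 → ℝ) := apSigma 3 * apSigma 2

lemma apT_inv : apT⁻¹ = apSigma 2 * apSigma 3 := by
  rw [apT, mul_inv_rev, apSigma_inv, apSigma_inv]

lemma conj_apT (k : ℤ) : apSigma 3 * apT ^ k = apT ^ (-k) * apSigma 3 := by
  have h : SemiconjBy (apSigma 3) apT apT⁻¹ := by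
    rw [SemiconjBy, apT_inv, apT, ← mul_assoc, apSigma_mul_self, one_mul, mul_assoc,
      apSigma_mul_self, mul_one]
  have := h.zpow_right k
  rw [inv_zpow'] at this
  exact this

/-- Enumeration of the group. -/
def apw (n : ℤ) : (Fin 4 → ℝ) ≃ₗ[ℝ] (Fin 4 → ℝ) :=
  if n % 2 = 0 then apT ^ (n / 2) else apT ^ (n / 2) * apSigma 3

lemma apw_even (k : ℤ) : apw (2 * k) = apT ^ k := by
  simp [apw]

lemma apw_odd (k : ℤ) : apw (2 * k + 1) = apT ^ k * apSigma 3 := by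
  have h1 : (2 * k + 1) % 2 = 1 := by omega
  have h2 : (2 * k + 1) / 2 = k := by omega
  simp [apw, h1, h2]

lemma sigma3_apw (n : ℤ) : apSigma 3 * apw n = apw (1 - n) := by
  obtain ⟨k, rfl | rfl⟩ := Int.even_or_odd' n
  · rw [show 1 - 2 * k = 2 * (-k) + 1 by ring, apw_even, apw_odd, conj_apT]
  · rw [show 1 - (2 * k + 1) = 2 * (-k) by ring, apw_even, apw_odd, ← mul_assoc, conj_apT,
      mul_assoc, apSigma_mul_self, mul_one]

lemma T_apw (n : ℤ) : apT⁻¹ * apw n = apw (n - 2) := by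
  obtain ⟨k, rfl | rfl⟩ := Int.even_or_odd' n
  · rw [show 2 * k - 2 = 2 * (-1 + k) by ring, apw_even, apw_even, zpow_add, zpow_neg_one]
  · rw [show 2 * k + 1 - 2 = 2 * (-1 + k) + 1 by ring, apw_odd, apw_odd, zpow_add, zpow_neg_one,
      mul_assoc]

lemma sigma2_apw (n : ℤ) : apSigma 2 * apw n = apw (-1 - n) := by
  have : apSigma 2 = apT⁻¹ * apSigma 3 := by
    rw [apT_inv, mul_assoc, apSigma_mul_self, mul_one]
  rw [this, mul_assoc, sigma3_apw, T_apw]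
  congr 1; ring

lemma apw_mem (n : ℤ) : apw n ∈ apW2 := by
  have h2 : apSigma 2 ∈ apW2 := Subgroup.subset_closure (by simp)
  have h3 : apSigma 3 ∈ apW2 := Subgroup.subset_closure (by simp)
  have hT : apT ∈ apW2 := mul_mem h3 h2
  obtain ⟨k, rfl | rfl⟩ := Int.even_or_odd' n
  · rw [apw_even]; exact zpow_mem hT k
  · rw [apw_odd]; exact mul_mem (zpow_mem hT k) h3

lemma exists_apw (w : (Fin 4 → ℝ) ≃ₗ[ℝ] (Fin 4 → ℝ)) (hw : w ∈ apW2) : ∃ n, apw n = w := by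
  unfold apW2 at hw
  induction hw using Subgroup.closure_induction_left with
  | one => exact ⟨0, by simp [apw]⟩
  | mul_left x hx y hy ih =>
    obtain ⟨n, rfl⟩ := ih
    rcases hx with rfl | rfl
    · exact ⟨_, (sigma2_apw n).symm⟩
    · exact ⟨_, (sigma3_apw n).symm⟩
  | inv_mul_cancel x hx y hy ih =>
    obtain ⟨n, rfl⟩ := ih
    rcases hx with rfl | rfl
    · exact ⟨_, by rw [apSigma_inv]; exact (sigma2_apw n).symm⟩
    · exact ⟨_, by rw [apSigma_inv]; exact (sigma3_apw n).symm⟩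

/-- The orbit points. -/
def apv (c : Fin 4 → ℝ) (n : ℤ) : Fin 4 → ℝ :=
  ![c 0, c 1, c 2 + (c 0 + c 1) * (n ^ 2 - n), c 2 + (c 0 + c 1) * (n ^ 2 + n)]

lemma sigma2_apv (c : Fin 4 → ℝ) (n : ℤ) : apSigma 2 (apv c n) = apv c (-1 - n) := by
  change Function.update _ _ _ = _
  funext j
  fin_cases j <;> simp [apv, Function.update, Fin.sum_univ_four] <;>
    first | ring1 | (left; ring1)

lemma sigma3_apv (c : Fin 4 → ℝ) (n : ℤ) : apSigma 3 (apv c n) = apv c (1 - n) := by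
  change Function.update _ _ _ = _
  funext j
  fin_cases j <;> simp [apv, Function.update, Fin.sum_univ_four] <;>
    first | ring1 | (left; ring1)

lemma T_apv (c : Fin 4 → ℝ) (n : ℤ) : apT (apv c n) = apv c (n + 2) := by
  rw [apT, LinearEquiv.mul_apply, sigma2_apv, sigma3_apv]
  congr 1; ring

lemma Tinv_apv (c : Fin 4 → ℝ) (n : ℤ) : apT⁻¹ (apv c n) = apv c (n - 2) := by
  rw [apT_inv, LinearEquiv.mul_apply, sigma3_apv, sigma2_apv]
  congr 1; ring

lemma Tpow_apv (c : Fin 4 → ℝ) (k n : ℤ) : (apT ^ k) (apv c n) = apv c (n + 2 * k) := by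
  induction k using Int.induction_on with
  | zero => simp
  | succ i ih =>
    rw [add_comm, zpow_add, zpow_one, LinearEquiv.mul_apply, ih, T_apv]
    congr 1; ring
  | pred i ih =>
    rw [sub_eq_add_neg, add_comm, zpow_add, zpow_neg_one, LinearEquiv.mul_apply, ih, Tinv_apv]
    congr 1; ring

lemma apw_apv (c : Fin 4 → ℝ) (n : ℤ) : apw n (apv c 0) = apv c n := by
  obtain ⟨k, rfl | rfl⟩ := Int.even_or_odd' n
  · rw [apw_even, Tpow_apv, zero_add]
  · rw [apw_odd, LinearEquiv.mul_apply, sigma3_apv, Tpow_apv]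
    congr 1; ring

lemma apw_inj : Function.Injective apw := by
  intro m n h
  have h1 : apv ![1, 0, 0, 0] m = apv ![1, 0, 0, 0] n := by
    rw [← apw_apv _ m, ← apw_apv _ n, h]
  have h2 := congrFun h1 2
  have h3 := congrFun h1 3
  simp [apv] at h2 h3
  have : (m : ℝ) = n := by linarith
  exact_mod_cast this

lemma det_sigma2 : LinearMap.det (sigmaL 2) = -1 := by
  rw [← LinearMap.det_toMatrix']
  have h : LinearMap.toMatrix' (sigmaL 2) = (!![1,0,0,0;0,1,0,0;2,2,-1,2;0,0,0,1] : Matrix (Fin 4) (Fin 4) ℝ) := by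
    ext a b
    rw [LinearMap.toMatrix'_apply]
    change Function.update _ _ _ _ = _
    fin_cases a <;> fin_cases b <;>
      simp [Function.update, Fin.sum_univ_four] <;> norm_num
  rw [h]
  simp [Matrix.det_succ_row_zero, Fin.sum_univ_succ, Fin.succAbove]

lemma det_sigma3 : LinearMap.det (sigmaL 3) = -1 := by
  rw [← LinearMap.det_toMatrix']
  have h : LinearMap.toMatrix' (sigmaL 3) = (!![1,0,0,0;0,1,0,0;0,0,1,0;2,2,2,-1] : Matrix (Fin 4) (Fin 4) ℝ) := by
    ext a b
    rw [LinearMap.toMatrix'_apply]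
    change Function.update _ _ _ _ = _
    fin_cases a <;> fin_cases b <;>
      simp [Function.update, Fin.sum_univ_four] <;> norm_num
  rw [h]
  simp [Matrix.det_succ_row_zero, Fin.sum_univ_succ, Fin.succAbove]

lemma det_T : LinearEquiv.det apT = 1 := by
  ext
  rw [LinearEquiv.coe_det]
  change LinearMap.det (sigmaL 3 ∘ₗ sigmaL 2) = _
  rw [LinearMap.det_comp, det_sigma2, det_sigma3]; norm_num

lemma det_apw (n : ℤ) : LinearMap.det (apw n).toLinearMap = (-1 : ℝ) ^ n := by
  rw [← LinearEquiv.coe_det]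
  obtain ⟨k, rfl | rfl⟩ := Int.even_or_odd' n
  · rw [apw_even, map_zpow, det_T]; simp [zpow_mul]
  · rw [apw_odd, map_mul, map_zpow, det_T, one_zpow, one_mul, LinearEquiv.coe_det,
      zpow_add₀ (by norm_num), zpow_mul]
    have h : LinearMap.det (apSigma 3).toLinearMap = -1 := det_sigma3
    rw [h]; simp

/-- The enumeration as an equivalence. -/
def apE : ℤ ≃ apW2 := Equiv.ofBijective (fun n => ⟨apw n, apw_mem n⟩)
  ⟨fun _ _ h => apw_inj (congrArg Subtype.val h), fun w => by
    obtain ⟨n, hn⟩ := exists_apw w.1 w.2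
    exact ⟨n, Subtype.ext hn⟩⟩

lemma term_eq (c : Fin 4 → ℝ) (hcc : c 2 = c 3) (s : Fin 4 → ℂ) (n : ℤ) :
    Complex.exp (-pairC (apw n c) s) = Complex.exp (-pairC c s) *
      jacobiTheta₂_term n
        (((c 0 + c 1 : ℝ) : ℂ) * (s 2 - s 3) / (2 * (Real.pi : ℂ) * Complex.I))
          (-(((c 0 + c 1 : ℝ) : ℂ) * (s 2 + s 3)) / ((Real.pi : ℂ) * Complex.I)) := by
  have h0 : apv c 0 = c := by
    funext j
    fin_cases j <;> simp [apv, hcc]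
  have h1 : apw n c = apv c n := by
    conv_lhs => rw [← h0]
    exact apw_apv c n
  have hpi : (Real.pi : ℂ) ≠ 0 := by exact_mod_cast Real.pi_ne_zero
  rw [h1, jacobiTheta₂_term, ← Complex.exp_add]
  congr 1
  have e1 : 2 * (Real.pi : ℂ) * I * n *
      (((c 0 + c 1 : ℝ) : ℂ) * (s 2 - s 3) / (2 * (Real.pi : ℂ) * Complex.I))
      = n * (((c 0 + c 1 : ℝ) : ℂ) * (s 2 - s 3)) := by
    field_simp [I_ne_zero]
  have e2 : (Real.pi : ℂ) * I * n ^ 2 *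
      (-(((c 0 + c 1 : ℝ) : ℂ) * (s 2 + s 3)) / ((Real.pi : ℂ) * Complex.I))
      = - (n ^ 2 * (((c 0 + c 1 : ℝ) : ℂ) * (s 2 + s 3))) := by
    field_simp [I_ne_zero]
  rw [e1, e2]
  simp [pairC, apv, Fin.sum_univ_four, ← hcc]
  ring

lemma term_half (n : ℤ) (z τ : ℂ) :
    jacobiTheta₂_term n (z + 1 / 2) τ = (-1 : ℂ) ^ n * jacobiTheta₂_term n z τ := by
  rw [jacobiTheta₂_term, jacobiTheta₂_term, ← Complex.exp_pi_mul_I, ← Complex.exp_int_mul,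
    ← Complex.exp_add]
  congr 1; ring

/-- In the symmetric case `c₃ = c₄`, the `W₂`-orbit sums are single theta functions:
`Z₂⁺` is `θ₀₀` and the signed sum `Z₂⁻` is `θ₀₁`. -/
theorem Z2_symmetric_theta (c : Fin 4 → ℝ) (hc : 0 < c 0 + c 1) (hcc : c 2 = c 3)
    (s : Fin 4 → ℂ) (hs : 0 < (s 2).re + (s 3).re) :
    (∑' w : apW2, Complex.exp (-pairC ((w : (Fin 4 → ℝ) ≃ₗ[ℝ] (Fin 4 → ℝ)) c) s)) =
      Complex.exp (-pairC c s) *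
        jacobiTheta₂ (((c 0 + c 1 : ℝ) : ℂ) * (s 2 - s 3) / (2 * (Real.pi : ℂ) * Complex.I))
          (-(((c 0 + c 1 : ℝ) : ℂ) * (s 2 + s 3)) / ((Real.pi : ℂ) * Complex.I)) ∧
    (∑' w : apW2, ((LinearMap.det (w : (Fin 4 → ℝ) ≃ₗ[ℝ] (Fin 4 → ℝ)).toLinearMap : ℝ) : ℂ)
        * Complex.exp (-pairC ((w : (Fin 4 → ℝ) ≃ₗ[ℝ] (Fin 4 → ℝ)) c) s)) =
      Complex.exp (-pairC c s) *
        theta01 (((c 0 + c 1 : ℝ) : ℂ) * (s 2 - s 3) / (2 * (Real.pi : ℂ) * Complex.I))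
          (-(((c 0 + c 1 : ℝ) : ℂ) * (s 2 + s 3)) / ((Real.pi : ℂ) * Complex.I)) := by
  constructor
  · rw [← apE.tsum_eq, jacobiTheta₂, ← tsum_mul_left]
    exact tsum_congr fun n => term_eq c hcc s n
  · rw [← apE.tsum_eq, theta01, jacobiTheta₂, ← tsum_mul_left]
    refine tsum_congr fun n => ?_
    rw [term_half]
    have hd : LinearMap.det ((apE n : (Fin 4 → ℝ) ≃ₗ[ℝ] (Fin 4 → ℝ))).toLinearMap
        = (-1 : ℝ) ^ n := det_apw n
    have ht := term_eq c hcc s n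
    have hw : ((apE n : (Fin 4 → ℝ) ≃ₗ[ℝ] (Fin 4 → ℝ))) = apw n := rfl
    rw [hd, hw, ht]
    push_cast
    ring
end
end

section
/- Let c ∈ ℝ⁴ be a base quadruple of a bounded Apollonian packing, and let s ∈ ℝ⁴ satisfy the twelve inequalities sᵢ > −2sⱼ for all i ≠ j. Then the family (exp(−⟨w·c, s⟩))_{w ∈ W}, indexed by the elements of the Apollonian group W, is summable. -/
open Finset Complex

noncomputable section

/-- The Descartes quadratic form `F(x) = 2(x₁²+x₂²+x₃²+x₄²) − (x₁+x₂+x₃+x₄)²`. -/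
def DescartesF (x : Fin 4 → ℝ) : ℝ := 2 * (∑ i, (x i)^2) - (∑ i, x i)^2

/-- Height of a vector: the sum of its coordinates. -/
def ht (x : Fin 4 → ℝ) : ℝ := ∑ i, x i

/-- The Apollonian group `W`, generated by the four reflections `σ₁, σ₂, σ₃, σ₄`. -/
def apW : Subgroup ((Fin 4 → ℝ) ≃ₗ[ℝ] (Fin 4 → ℝ)) :=
  Subgroup.closure {apSigma 0, apSigma 1, apSigma 2, apSigma 3}

/-- The pairing `⟨x,s⟩ = x₁s₁+x₂s₂+x₃s₃+x₄s₄` of real vectors. -/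
def pairR (x s : Fin 4 → ℝ) : ℝ := ∑ i, x i * s i

/-- `c` is a base quadruple of a bounded Apollonian packing: `F(c) = 0`, exactly one
coordinate of `c` is negative, and `2cᵢ ≤ ht(c)` for every `i`. -/
def IsBaseQuadruple (c : Fin 4 → ℝ) : Prop :=
  DescartesF c = 0 ∧ (∃! i, c i < 0) ∧ ∀ i, 2 * c i ≤ ht c

lemma apSigma_apply (i : Fin 4) (x : Fin 4 → ℝ) :
    apSigma i x = Function.update x i (2 * (∑ j, x j) - 3 * x i) := rfl

lemma apSigma_mem (i : Fin 4) : apSigma i ∈ apW := by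
  apply Subgroup.subset_closure
  fin_cases i <;> simp

lemma apSigma_ht (i : Fin 4) (x : Fin 4 → ℝ) : ht (apSigma i x) = 3 * ht x - 4 * x i := by
  rw [apSigma_apply]
  unfold ht
  fin_cases i <;> simp [Fin.sum_univ_four, Function.update] <;> ring

lemma apSigma_F (i : Fin 4) (x : Fin 4 → ℝ) : DescartesF (apSigma i x) = DescartesF x := by
  rw [apSigma_apply]
  unfold DescartesF
  fin_cases i <;> simp [Fin.sum_univ_four, Function.update] <;> ring

lemma apSigma_self (i : Fin 4) (x : Fin 4 → ℝ) : apSigma i x i = 2 * ht x - 3 * x i := by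
  simp [apSigma_apply, ht]

lemma apSigma_ne {i j : Fin 4} (h : j ≠ i) (x : Fin 4 → ℝ) : apSigma i x j = x j := by
  simp [apSigma_apply, h]

lemma apW_ind (P : ((Fin 4 → ℝ) ≃ₗ[ℝ] (Fin 4 → ℝ)) → Prop) (h1 : P 1)
    (hs : ∀ i w, P w → P (apSigma i * w)) : ∀ w ∈ apW, P w := by
  intro w hw
  have key : ∀ x, x ∈ ({apSigma 0, apSigma 1, apSigma 2, apSigma 3} :
      Set ((Fin 4 → ℝ) ≃ₗ[ℝ] (Fin 4 → ℝ))) → ∃ i, x = apSigma i := by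
    rintro x (h | h | h | h)
    exacts [⟨_, h⟩, ⟨_, h⟩, ⟨_, h⟩, ⟨_, h⟩]
  unfold apW at hw
  induction hw using Subgroup.closure_induction_left with
  | one => exact h1
  | mul_left x hx y hy ih =>
    obtain ⟨i, rfl⟩ := key x hx
    exact hs i y ih
  | inv_mul_cancel x hx y hy ih =>
    obtain ⟨i, rfl⟩ := key x hx
    rw [inv_eq_of_mul_eq_one_left (apSigma_mul_self i)]
    exact hs i y ih

/-- Reduced words with a leftmost letter. -/
inductive ApRed : Option (Fin 4) → ((Fin 4 → ℝ) ≃ₗ[ℝ] (Fin 4 → ℝ)) → Prop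
  | one : ApRed none 1
  | cons (i : Fin 4) (k : Option (Fin 4)) (w) (h : ApRed k w) (hk : k ≠ some i) :
      ApRed (some i) (apSigma i * w)

lemma exists_ApRed : ∀ w ∈ apW, ∃ k, ApRed k w := by
  apply apW_ind
  · exact ⟨_, ApRed.one⟩
  · rintro i w ⟨k, hk⟩
    by_cases h : k = some i
    · subst h
      cases hk with
      | cons _ k' w' h' hk' =>
        refine ⟨k', ?_⟩
        rw [← mul_assoc, apSigma_mul_self, one_mul]
        exact h'
    · exact ⟨_, ApRed.cons i k w hk h⟩

lemma ApRed_inv (x : Fin 4 → ℝ) (hx : ∀ i, 2 * x i ≤ ht x) (k) (w) (h : ApRed k w) :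
    (∀ i, x i ≤ w x i) ∧ (∀ i, k ≠ some i → 0 ≤ ht (w x) - 2 * w x i) ∧
    (∀ i j, k = some i → j ≠ i → 0 ≤ (ht (w x) - 2 * w x i) + (ht (w x) - 2 * w x j)) := by
  induction h with
  | one => 
    refine ⟨fun i => le_rfl, fun i _ => ?_, fun i j h => by simp at h⟩
    have := hx i
    simp only [LinearEquiv.coe_one, id]
    linarith
  | cons i k w h hk ih =>
    obtain ⟨h1, h2, h3⟩ := ih
    have hi := h2 i hk
    have hj : ∀ j, j ≠ i → 0 ≤ (ht (w x) - 2 * w x j) + (ht (w x) - 2 * w x i) := by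
      intro j hji
      by_cases hkj : k = some j
      · exact h3 j i hkj hji.symm
      · have := h2 j hkj
        linarith
    simp only [LinearEquiv.mul_apply]
    refine ⟨fun j => ?_, fun j hkj => ?_, fun i' j hi' hj' => ?_⟩
    · by_cases hji : j = i
      · subst hji
        rw [apSigma_self]
        have := h1 j
        linarith
      · rw [apSigma_ne hji]
        exact h1 j
    · have hji : j ≠ i := fun h => hkj (by rw [h])
      rw [apSigma_ht, apSigma_ne hji]
      have := hj j hji
      linarith
    · have : i = i' := by simpa using hi'
      subst this
      rw [apSigma_ht, apSigma_ne hj', apSigma_self]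
      have := hj j hj'
      linarith

lemma dom_le (x : Fin 4 → ℝ) (hx : ∀ i, 2 * x i ≤ ht x) (w) (hw : w ∈ apW) (i : Fin 4) :
    x i ≤ w x i := by
  obtain ⟨k, hk⟩ := exists_ApRed w hw
  exact (ApRed_inv x hx k w hk).1 i

lemma coord_le (x : Fin 4 → ℝ) (h : DescartesF x ≤ 0) (h0 : 0 ≤ ht x) (i : Fin 4) :
    |x i| * (4/3) ≤ ht x := by
  have h1 : (|x i| * (4/3))^2 ≤ (ht x)^2 := by
    rw [mul_pow, sq_abs]
    unfold DescartesF at h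
    unfold ht
    simp only [Fin.sum_univ_four] at *
    fin_cases i <;> simp only [Fin.zero_eta, Fin.mk_one, Fin.reduceFinMk] <;>
    nlinarith [sq_nonneg (x 0), sq_nonneg (x 1), sq_nonneg (x 2), sq_nonneg (x 3)]
  exact le_of_sq_le_sq h1 h0

lemma cone_pres (x : Fin 4 → ℝ) (h : DescartesF x ≤ 0) (h0 : 0 ≤ ht x) :
    ∀ w ∈ apW, DescartesF (w x) ≤ 0 ∧ 0 ≤ ht (w x) := by
  apply apW_ind
  · exact ⟨h, h0⟩
  · rintro i w ⟨h1, h2⟩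
    simp only [LinearEquiv.mul_apply]
    rw [apSigma_F, apSigma_ht]
    refine ⟨h1, ?_⟩
    have := coord_le _ h1 h2 i
    have := le_abs_self (w x i)
    linarith

lemma int_pres : ∀ w ∈ apW, ∀ x : Fin 4 → ℝ, (∀ i, ∃ n : ℤ, x i = n) →
    ∀ i, ∃ n : ℤ, w x i = n := by
  apply apW_ind
  · intro x hx; exact hx
  · intro i w ih x hx j
    have h := ih x hx
    choose n hn using h
    simp only [LinearEquiv.mul_apply]
    by_cases hji : j = i
    · subst hji
      rw [apSigma_self]
      refine ⟨2 * (∑ k, n k) - 3 * n j, ?_⟩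
      simp [ht, hn]
    · rw [apSigma_ne hji]
      exact ⟨n j, hn j⟩

lemma ht_add (x y : Fin 4 → ℝ) : ht (x + y) = ht x + ht y := by
  simp [ht, Finset.sum_add_distrib]

lemma ht_smul (r : ℝ) (x : Fin 4 → ℝ) : ht (r • x) = r * ht x := by
  simp [ht, Finset.mul_sum]

lemma ht_pos {c : Fin 4 → ℝ} (hc : IsBaseQuadruple c) : 0 < ht c := by
  obtain ⟨hF, ⟨j, hj, -⟩, hd⟩ := hc
  have h0 : 0 ≤ ht c := by
    have a0 := hd 0
    have a1 := hd 1
    have a2 := hd 2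
    have a3 := hd 3
    simp only [ht, Fin.sum_univ_four] at *
    linarith
  refine lt_of_le_of_ne h0 fun h => ?_
  have := coord_le c hF.le h0 j
  have := abs_pos_of_neg hj
  linarith

lemma exists_timelike {c : Fin 4 → ℝ} (hc : IsBaseQuadruple c) :
    ∃ u v : Fin 4 → ℝ, c = u + v ∧ DescartesF u < 0 ∧ 0 < ht u ∧ 
      ∀ w ∈ apW, 0 ≤ ht (w v) := by
  have hp := ht_pos hc
  obtain ⟨hF, ⟨j, hj, -⟩, hd⟩ := hc
  set t := min (-c j) (ht c / 4) with ht_def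
  have t0 : 0 < t := lt_min (by linarith) (by linarith)
  have t1 : t ≤ -c j := min_le_left _ _
  have t2 : t ≤ ht c / 4 := min_le_right _ _
  have hv : ht (Function.update (fun _ => t) j (-t)) = 2 * t := by
    unfold ht
    fin_cases j <;> simp [Fin.sum_univ_four, Function.update] <;> ring
  refine ⟨c - Function.update (fun _ => t) j (-t), Function.update (fun _ => t) j (-t),
    by simp, ?_, ?_, ?_⟩
  · have : DescartesF (c - Function.update (fun _ => t) j (-t)) =
      DescartesF c + 8 * t * c j + 4 * t^2 := by
      clear_value t
      unfold DescartesF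
      fin_cases j <;> simp [Fin.sum_univ_four, Function.update] <;> ring
    rw [this, hF]
    nlinarith
  · have := ht_add (c - Function.update (fun _ => t) j (-t)) (Function.update (fun _ => t) j (-t))
    rw [sub_add_cancel, hv] at this
    linarith
  · intro w hw
    have hdom : ∀ i, 2 * (Function.update (fun _ => t) j (-t) : Fin 4 → ℝ) i
        ≤ ht (Function.update (fun _ => t) j (-t)) := by
      intro i
      rw [hv]
      by_cases h : i = j
      · subst h; simp; linarith
      · simp [h]
    have h2 : ht (Function.update (fun _ => t) j (-t)) ≤
        ht (w (Function.update (fun _ => t) j (-t))) :=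
      Finset.sum_le_sum fun i _ => dom_le _ hdom w hw i
    linarith

lemma exists_delta {c : Fin 4 → ℝ} (hc : IsBaseQuadruple c) (e : Fin 4 → ℝ) :
    ∃ δ : ℝ, 0 < δ ∧ ∀ w ∈ apW, ∀ i, δ * |w e i| ≤ ht (w c) := by
  obtain ⟨u, v, rfl, hF, hu, hv⟩ := exists_timelike hc
  have hcF : Continuous fun r : ℝ => DescartesF (u + r • e) := by
    unfold DescartesF; simp only [Pi.add_apply, Pi.smul_apply]; fun_prop
  have hcH : Continuous fun r : ℝ => ht (u + r • e) := by
    unfold ht; simp only [Pi.add_apply, Pi.smul_apply]; fun_prop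
  have ev1 : ∀ᶠ r in nhds (0:ℝ), DescartesF (u + r • e) < 0 :=
    hcF.continuousAt.eventually_lt continuousAt_const (by simpa using hF)
  have ev2 : ∀ᶠ r in nhds (0:ℝ), 0 < ht (u + r • e) :=
    continuousAt_const.eventually_lt hcH.continuousAt (by simpa using hu)
  obtain ⟨ε, hε, hb⟩ := Metric.eventually_nhds_iff.1 (ev1.and ev2)
  have key : ∀ r : ℝ, |r| < ε → ∀ w ∈ apW, ∀ i,
      |w u i + r * w e i| ≤ ht (w u) + r * ht (w e) := by
    intro r hr w hw i
    obtain ⟨h1, h2⟩ := hb (y := r) (by simpa using hr)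
    obtain ⟨h3, h4⟩ := cone_pres _ h1.le h2.le w hw
    have := coord_le _ h3 h4 i
    have h5 := abs_nonneg (w (u + r • e) i)
    rw [map_add, map_smul, ht_add, ht_smul] at *
    simp only [Pi.add_apply, Pi.smul_apply, smul_eq_mul] at *
    linarith
  refine ⟨ε / 2, by linarith, fun w hw i => ?_⟩
  have h1 := key (ε/2) (by rw [abs_of_pos] <;> linarith) w hw i
  have h2 := key (-(ε/2)) (by rw [abs_neg, abs_of_pos] <;> linarith) w hw i
  have h3 := hv w hw
  rw [map_add, ht_add]
  rw [abs_le] at h1 h2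
  have : |w e i| ≤ ht (w u) / (ε/2) := by
    rw [abs_le, ← neg_div, div_le_iff₀ (by linarith), le_div_iff₀ (by linarith)]
    constructor <;> linarith
  rw [le_div_iff₀ (by linarith)] at this
  linarith

lemma pair_lower (K : ℝ) (s : Fin 4 → ℝ) (hs : ∀ i j : Fin 4, i ≠ j → 0 ≤ s i + 2 * s j) :
    ∃ C : ℝ, ∀ x : Fin 4 → ℝ, (∀ i, -K ≤ x i) → (∀ i, -K ≤ 2 * ht x - 3 * x i) →
      -C ≤ pairR x s := by
  by_cases h : ∀ i, 0 ≤ s i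
  · refine ⟨K * ∑ i, s i, fun x h1 _ => ?_⟩
    rw [Finset.mul_sum, ← Finset.sum_neg_distrib]
    refine Finset.sum_le_sum fun i _ => ?_
    have := mul_le_mul_of_nonneg_right (h1 i) (h i)
    linarith
  · push Not at h
    obtain ⟨j, hj⟩ := h
    refine ⟨K * (-s j) + K * ∑ i, (if i = j then 0 else s i + 2 * s j), fun x h1 h2 => ?_⟩
    have e : pairR x s = (-s j) * (2 * ht x - 3 * x j) +
        ∑ i, x i * (if i = j then 0 else s i + 2 * s j) := by
      unfold pairR ht
      fin_cases j <;> simp [Fin.sum_univ_four] <;> ring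
    have a : -(K * ∑ i, (if i = j then 0 else s i + 2 * s j)) ≤
        ∑ i, x i * (if i = j then 0 else s i + 2 * s j) := by
      rw [Finset.mul_sum, ← Finset.sum_neg_distrib]
      refine Finset.sum_le_sum fun i _ => ?_
      by_cases hij : i = j
      · simp [hij]
      · simp only [hij, if_false]
        have := mul_le_mul_of_nonneg_right (h1 i) (hs i j hij)
        linarith
    have b := mul_le_mul_of_nonneg_right (h2 j) (neg_nonneg.2 hj.le)
    rw [e]
    linarith

lemma summable_pi {α : Type*} (f : α → ℝ) (h0 : ∀ a, 0 ≤ f a) (hf : Summable f) (n : ℕ) :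
    Summable fun v : Fin n → α => ∏ i, f (v i) := by
  induction n with
  | zero => exact Summable.of_finite
  | succ n ih =>
    have := hf.mul_of_nonneg ih h0 (fun v => Finset.prod_nonneg fun i _ => h0 _)
    rw [← (Fin.consEquiv (fun _ : Fin (n+1) => α)).summable_iff]
    refine this.congr fun p => ?_
    simp [Fin.prod_univ_succ, Fin.consEquiv]

lemma summable_exp_int (a : ℝ) (ha : 0 < a) : Summable fun n : ℤ => Real.exp (-a * |(n:ℝ)|) := by
  have h : Summable fun n : ℕ => Real.exp (-a * n) := by
    have := Real.summable_exp_nat_mul_iff.2 (neg_lt_zero.2 ha)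
    exact this.congr fun n => by rw [mul_comm]
  refine Summable.of_nat_of_neg ?_ ?_ <;> simpa using h

/-- The generating function `Z(s)` of a bounded Apollonian packing converges absolutely
on the simplicial cone `C₁` cut out by the twelve inequalities `sᵢ > −2sⱼ` for `i ≠ j`. -/
theorem summable_on_C1 (c : Fin 4 → ℝ) (hc : IsBaseQuadruple c)
    (s : Fin 4 → ℝ) (hs : ∀ i j : Fin 4, i ≠ j → -2 * s j < s i) :
    Summable fun w : apW => Real.exp (-pairR ((w : (Fin 4 → ℝ) ≃ₗ[ℝ] (Fin 4 → ℝ)) c) s) := by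
  -- the margin
  obtain ⟨ε, hε, hsε⟩ : ∃ ε : ℝ, 0 < ε ∧ ∀ i j : Fin 4, i ≠ j → 3 * ε ≤ s i + 2 * s j := by
    have : ∀ᶠ ε in nhdsWithin (0:ℝ) (Set.Ioi 0),
        ∀ i j : Fin 4, i ≠ j → 3 * ε ≤ s i + 2 * s j := by
      rw [Filter.eventually_all]; intro i
      rw [Filter.eventually_all]; intro j
      by_cases hij : i = j
      · simp [hij]
      · have h := hs i j hij
        have : ∀ᶠ ε in nhds (0:ℝ), 3 * ε < s i + 2 * s j :=
          ContinuousAt.eventually_lt (by fun_prop) continuousAt_const (by linarith)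
        filter_upwards [nhdsWithin_le_nhds this] with ε h _ using h.le
    obtain ⟨ε, h1, h2⟩ := (this.and self_mem_nhdsWithin).exists
    exact ⟨ε, h2, h1⟩
  obtain ⟨C, hC⟩ := pair_lower (∑ i, |c i|) (fun i => s i - ε)
    (fun i j hij => by have := hsε i j hij; linarith)
  have hlow : ∀ w ∈ apW, ∀ i, -(∑ i, |c i|) ≤ w c i := fun w hw i => by
    have h1 := dom_le c hc.2.2 w hw i
    have h2 := Finset.single_le_sum (f := fun i => |c i|) (fun i _ => abs_nonneg _)
      (Finset.mem_univ i)
    have h3 := neg_abs_le (c i)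
    linarith
  have hpair : ∀ w ∈ apW, ε * ht (w c) - C ≤ pairR (w c) s := fun w hw => by
    have h1 := hC (w c) (hlow w hw) (fun i => by
      have := hlow (apSigma i * w) (apW.mul_mem (apSigma_mem i) hw) i
      rwa [LinearEquiv.mul_apply, apSigma_self] at this)
    have h2 : pairR (w c) (fun i => s i - ε) = pairR (w c) s - ε * ht (w c) := by
      simp only [pairR, ht, Fin.sum_univ_four]; ring
    linarith
  choose δ hδ hδw using fun j : Fin 4 => exists_delta hc (Pi.single j 1)
  obtain ⟨d, hd, hdδ⟩ : ∃ d : ℝ, 0 < d ∧ ∀ j, d ≤ δ j :=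
    ⟨Finset.univ.inf' Finset.univ_nonempty δ, by simpa using hδ,
      fun j => Finset.inf'_le _ (Finset.mem_univ j)⟩
  have hint : ∀ w : apW, ∀ j i, ∃ n : ℤ, w.1 (Pi.single j 1) i = n := fun w j => by
    refine int_pres w.1 w.2 _ fun i => ⟨if i = j then 1 else 0, ?_⟩
    by_cases h : i = j <;> simp [h]
  choose N hN using hint
  have hinj : Function.Injective N := by
    intro w w' h
    apply Subtype.ext
    apply LinearEquiv.toLinearMap_injective
    apply LinearMap.pi_ext'
    intro j
    ext i
    simp [hN, h]
  have ha : 0 < ε * d / 16 := by positivity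
  have hsum := summable_pi (fun v : Fin 4 → ℤ => ∏ i, Real.exp (-(ε * d / 16) * |(v i : ℝ)|))
    (fun v => Finset.prod_nonneg fun i _ => (Real.exp_pos _).le)
    (summable_pi (fun n : ℤ => Real.exp (-(ε * d / 16) * |(n : ℝ)|))
      (fun n => (Real.exp_pos _).le) (summable_exp_int _ ha) 4) 4
  have hsum2 := (hsum.comp_injective hinj).mul_left (Real.exp C)
  refine Summable.of_nonneg_of_le (fun w => (Real.exp_pos _).le) (fun w => ?_) hsum2
  simp only [Function.comp, ← Real.exp_sum, ← Real.exp_add]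
  apply Real.exp_le_exp.2
  have h1 := hpair w.1 w.2
  have h2 : ∀ j i, d * |(N w j i : ℝ)| ≤ ht (w.1 c) := fun j i => by
    rw [← hN]
    exact (mul_le_mul_of_nonneg_right (hdδ j) (abs_nonneg _)).trans (hδw j w.1 w.2 i)
  have h3 : ∑ j, ∑ i, d * |(N w j i : ℝ)| ≤ ∑ j : Fin 4, ∑ i : Fin 4, ht (w.1 c) :=
    Finset.sum_le_sum fun j _ => Finset.sum_le_sum fun i _ => h2 j i
  simp only [← Finset.mul_sum] at h3 ⊢
  simp only [Finset.sum_const, Finset.card_univ, Fintype.card_fin, nsmul_eq_mul] at h3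
  push_cast at h3
  have h4 := mul_le_mul_of_nonneg_left h3 hε.le
  nlinarith
end
end

section
/- Let s ∈ ℝ⁴ with ht(s) > 0 and suppose s does not belong to the topological closure of A. Then there exists w ∈ W* such that w·s has three nonpositive coordinates of which at most one is zero; that is, w·s has three negative coordinates, or two negative coordinates and one zero coordinate. -/
open Finset Complex

noncomputable section

/-- The dual Apollonian reflection as a linear map: it sends `s` to the vector with `i`-th
coordinate `−sᵢ` and `j`-th coordinate `sⱼ + 2sᵢ` for `j ≠ i`. -/
def tauL (i : Fin 4) : (Fin 4 → ℝ) →ₗ[ℝ] (Fin 4 → ℝ) where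
  toFun s := fun j => if j = i then -s i else s j + 2 * s i
  map_add' x y := by
    funext j
    rcases eq_or_ne j i with h | h <;> simp [h] <;> ring
  map_smul' r x := by
    funext j
    rcases eq_or_ne j i with h | h <;> simp [h] <;> ring

lemma tauL_invol (i : Fin 4) : Function.Involutive (tauL i) := by
  intro x
  funext j
  rcases eq_or_ne j i with h | h <;> simp [tauL, h] <;> ring

/-- The dual Apollonian reflection `τᵢ` (the transpose of `σᵢ`) as a linear automorphism. -/
def apTau (i : Fin 4) : (Fin 4 → ℝ) ≃ₗ[ℝ] (Fin 4 → ℝ) :=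
  LinearEquiv.ofInvolutive (tauL i) (tauL_invol i)

/-- The dual Apollonian group `W* = ⟨τ₁, τ₂, τ₃, τ₄⟩`. -/
def apWstar : Subgroup ((Fin 4 → ℝ) ≃ₗ[ℝ] (Fin 4 → ℝ)) :=
  Subgroup.closure {apTau 0, apTau 1, apTau 2, apTau 3}

/-- The set `C = {s ∈ ℝ⁴ : sᵢ ≥ 0 for all i, and at most one sᵢ = 0}`. -/
def setC : Set (Fin 4 → ℝ) :=
  {s | (∀ i, 0 ≤ s i) ∧ ∀ i j, s i = 0 → s j = 0 → i = j}

/-- The Apollonian cone `A = ⋃_{w ∈ W*} w(C)`. -/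
def setA : Set (Fin 4 → ℝ) :=
  ⋃ w ∈ apWstar, (w : (Fin 4 → ℝ) ≃ₗ[ℝ] (Fin 4 → ℝ)) '' setC



lemma apTau_apply (i : Fin 4) (x : Fin 4 → ℝ) (j : Fin 4) :
    apTau i x j = if j = i then -x i else x j + 2 * x i := rfl

lemma apTau_mem (i : Fin 4) : apTau i ∈ apWstar := by
  apply Subgroup.subset_closure
  fin_cases i <;> simp

lemma ht_apTau (i : Fin 4) (x : Fin 4 → ℝ) : ht (apTau i x) = ht x + 4 * x i := by
  unfold ht
  simp only [apTau_apply, Fin.sum_univ_four]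
  fin_cases i <;> simp <;> ring

def PP (x : Fin 4 → ℝ) : Prop := ∃ i j k : Fin 4, i ≠ j ∧ i ≠ k ∧ j ≠ k ∧
  ((x i < 0 ∧ x j < 0 ∧ x k < 0) ∨ (x i < 0 ∧ x j < 0 ∧ x k = 0))

lemma others (a : Fin 4) (x : Fin 4 → ℝ) : ∃ i j k : Fin 4, i ≠ j ∧ i ≠ k ∧ j ≠ k ∧
    a ≠ i ∧ a ≠ j ∧ a ≠ k ∧ ht x = x a + x i + x j + x k := by
  unfold ht
  simp only [Fin.sum_univ_four]
  fin_cases a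
  · exact ⟨1, 2, 3, by decide, by decide, by decide, by decide, by decide, by decide, by simp⟩
  · exact ⟨0, 2, 3, by decide, by decide, by decide, by decide, by decide, by decide, by simp; ring⟩
  · exact ⟨0, 1, 3, by decide, by decide, by decide, by decide, by decide, by decide, by simp; ring⟩
  · exact ⟨0, 1, 2, by decide, by decide, by decide, by decide, by decide, by decide, by simp; ring⟩

lemma PP_aux (x : Fin 4 → ℝ) (a i j k : Fin 4) (hij : i ≠ j) (hik : i ≠ k) (hjk : j ≠ k)
    (hi : a ≠ i) (hj : a ≠ j) (hk : a ≠ k) (ha : 0 < x a)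
    (hs : x a + x i + x j + x k ≤ 0) (h1 : x i ≤ x j) (h2 : x j ≤ x k) :
    PP x ∨ PP (apTau i x) := by
  by_cases hz : x k < 0
  · left
    exact ⟨i, j, k, hij, hik, hjk, Or.inl ⟨by linarith, by linarith, hz⟩⟩
  · right
    push Not at hz
    refine ⟨j, k, a, hjk, hj.symm, hk.symm, ?_⟩
    simp only [apTau_apply, hij.symm, hik.symm, hi, if_false]
    have h3 : x a + 2 * x i ≤ 0 := by linarith
    rcases h3.lt_or_eq with h | h
    · exact Or.inl ⟨by linarith, by linarith, h⟩
    · exact Or.inr ⟨by linarith, by linarith, h⟩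

lemma PP_of_ht (x : Fin 4 → ℝ) (a : Fin 4) (ha : 0 < x a) (hx : ht x ≤ 0) :
    ∃ w ∈ apWstar, PP (w x) := by
  have key : PP x ∨ ∃ i, PP (apTau i x) := by
    obtain ⟨i, j, k, hij, hik, hjk, hi, hj, hk, hh⟩ := others a x
    rw [hh] at hx
    rcases le_total (x i) (x j) with h1 | h1 <;> rcases le_total (x j) (x k) with h2 | h2 <;>
      rcases le_total (x i) (x k) with h3 | h3
    · exact (PP_aux x a i j k hij hik hjk hi hj hk ha (by linarith) h1 h2).imp_right fun h => ⟨_, h⟩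
    · exact (PP_aux x a i j k hij hik hjk hi hj hk ha (by linarith) h1 h2).imp_right fun h => ⟨_, h⟩
    · exact (PP_aux x a i k j hik hij hjk.symm hi hk hj ha (by linarith) h3 h2).imp_right
        fun h => ⟨_, h⟩
    · exact (PP_aux x a k i j hik.symm hjk.symm hij hk hi hj ha (by linarith) h3 h1).imp_right
        fun h => ⟨_, h⟩
    · exact (PP_aux x a j i k hij.symm hjk hik hj hi hk ha (by linarith) h1 h3).imp_right
        fun h => ⟨_, h⟩
    · exact (PP_aux x a j k i hjk hij.symm hik.symm hj hk hi ha (by linarith) h2 h3).imp_right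
        fun h => ⟨_, h⟩
    · exact (PP_aux x a k j i hjk.symm hik.symm hij.symm hk hj hi ha (by linarith) h2 h1).imp_right
        fun h => ⟨_, h⟩
    · exact (PP_aux x a k j i hjk.symm hik.symm hij.symm hk hj hi ha (by linarith) h2 h1).imp_right
        fun h => ⟨_, h⟩
  rcases key with h | ⟨i, h⟩
  · exact ⟨1, apWstar.one_mem, h⟩
  · exact ⟨apTau i, apTau_mem i, h⟩

/-- invariant of the walk -/
def WalkInv (ε e : ℝ) (x q : Fin 4 → ℝ) : Prop :=
  ε ≤ e ∧ (∀ k, 0 ≤ x k + e * q k) ∧ (∀ k, 0 < q k → 1 ≤ q k) ∧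
    (∀ k l, k ≠ l → 1 ≤ q k + q l) ∧ ∃ k, 0 < x k

lemma step (ε e : ℝ) (hε : 0 < ε) (x q : Fin 4 → ℝ) (h : WalkInv ε e x q)
    (hC : x + ε • q ∉ setC) :
    ∃ j e', WalkInv ε e' (apTau j x) (apTau j q) ∧ x j ≤ -ε := by
  obtain ⟨he, hx, hq1, hq2, -⟩ := h
  have hne : (Finset.univ.filter fun k => 0 < q k).Nonempty := by
    by_contra hcon
    rw [Finset.not_nonempty_iff_eq_empty] at hcon
    have h0 : ∀ k, ¬ 0 < q k := fun k hk => by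
      have : k ∈ (Finset.univ.filter fun k => 0 < q k) := by simp [hk]
      rw [hcon] at this
      simp at this
    have := hq2 0 1 (by decide)
    linarith [h0 0, h0 1]
  obtain ⟨j, hj, hmax⟩ := Finset.exists_max_image _ (fun k => -x k / q k) hne
  simp only [Finset.mem_filter, Finset.mem_univ, true_and] at hj hmax
  obtain ⟨e', hee⟩ : ∃ e', e' = -x j / q j := ⟨_, rfl⟩
  have hxj : x j = -(e' * q j) := by rw [hee]; field_simp; 
  rw [← hee] at hmax
  have hmax' : ∀ k, 0 < q k → 0 ≤ x k + e' * q k := by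
    intro k hk
    have := hmax k hk
    rw [div_le_iff₀ hk] at this
    linarith
  have hle : e' ≤ e := by
    have := hx j
    rw [hxj] at this
    by_contra hc
    push Not at hc
    nlinarith
  have hge : ε ≤ e' := by
    by_contra hc
    push Not at hc
    apply hC
    have hpos : ∀ k, 0 < q k → 0 < x k + ε * q k := by
      intro k hk
      nlinarith [hmax' k hk]
    refine ⟨fun k => ?_, fun k l hk hl => ?_⟩
    · simp only [Pi.add_apply, Pi.smul_apply, smul_eq_mul]
      by_cases hk : 0 < q k
      · exact (hpos k hk).le
      · push Not at hk
        nlinarith [hx k]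
    · simp only [Pi.add_apply, Pi.smul_apply, smul_eq_mul] at hk hl
      by_contra hkl
      have h1 : ¬ 0 < q k := fun h => by linarith [hpos k h]
      have h2 : ¬ 0 < q l := fun h => by linarith [hpos l h]
      linarith [hq2 k l hkl]
  have hqj := hq1 j hj
  have hnn : ∀ k, 0 ≤ x k + e' * q k := by
    intro k
    by_cases hk : 0 < q k
    · exact hmax' k hk
    · push Not at hk
      nlinarith [hx k]
  refine ⟨j, e', ⟨hge, ?_, ?_, ?_, j, ?_⟩, ?_⟩
  · intro k
    simp only [apTau_apply]
    split_ifs with hk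
    · linarith
    · nlinarith [hnn k]
  · intro k
    simp only [apTau_apply]
    split_ifs with hk
    · intro h; linarith
    · intro h
      linarith [hq2 k j hk]
  · intro k l hkl
    simp only [apTau_apply]
    split_ifs with hk hl hl
    · exact absurd (hk.trans hl.symm) hkl
    · linarith [hq2 l j hl]
    · linarith [hq2 k j hk]
    · linarith [hq2 k l hkl]
  · simp only [apTau_apply, if_true]
    nlinarith
  · nlinarith

lemma walk (ε : ℝ) (hε : 0 < ε) (s : Fin 4 → ℝ) (hs : s + ε • (fun _ => (1 : ℝ)) ∉ setA)
    (hht : 0 < ht s) (n : ℕ) :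
    ∃ w ∈ apWstar, (∃ e, WalkInv ε e (w s) (w fun _ => 1)) ∧ ht (w s) ≤ ht s - 4 * ε * n := by
  induction n with
  | zero =>
    refine ⟨1, apWstar.one_mem, ⟨ε + ∑ k, |s k|, ?_, ?_, ?_, ?_, ?_⟩, ?_⟩
    · have : 0 ≤ ∑ k, |s k| := Finset.sum_nonneg fun k _ => abs_nonneg _
      linarith
    · intro k
      have := Finset.single_le_sum (f := fun k => |s k|) (fun k _ => abs_nonneg _)
        (Finset.mem_univ k)
      change 0 ≤ s k + (ε + ∑ k, |s k|) * 1
      linarith [neg_abs_le (s k)]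
    · intro k _
      simp
    · intro k l _
      simp
    · by_contra hc
      push Not at hc
      have : ht s ≤ 0 := Finset.sum_nonpos fun k _ => hc k
      linarith
    · simp
  | succ n ih =>
    obtain ⟨w, hw, ⟨e, hI⟩, hh⟩ := ih
    have hC : w s + ε • (w fun _ => 1) ∉ setC := by
      intro hC
      apply hs
      simp only [setA, Set.mem_iUnion]
      refine ⟨w⁻¹, apWstar.inv_mem hw, _, hC, ?_⟩
      rw [← map_smul, ← map_add]
      exact w.symm_apply_apply _
    obtain ⟨j, e', hI', hj⟩ := step ε e hε _ _ hI hC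
    refine ⟨apTau j * w, apWstar.mul_mem (apTau_mem j) hw, ⟨e', hI'⟩, ?_⟩
    rw [LinearEquiv.mul_apply, ht_apTau]
    push_cast
    linarith

/-- Any point of positive height outside the closure of the Apollonian cone `A` has a
`W*`-translate with three negative coordinates, or two negative and one zero coordinate. -/
theorem outside_closure_three_nonpos (s : Fin 4 → ℝ)
    (hht : 0 < ht s) (hs : s ∉ closure setA) :
    ∃ w ∈ apWstar, ∃ i j k : Fin 4, i ≠ j ∧ i ≠ k ∧ j ≠ k ∧
      (((w : (Fin 4 → ℝ) ≃ₗ[ℝ] (Fin 4 → ℝ)) s i < 0 ∧ (w : (Fin 4 → ℝ) ≃ₗ[ℝ] (Fin 4 → ℝ)) s j < 0 ∧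
          (w : (Fin 4 → ℝ) ≃ₗ[ℝ] (Fin 4 → ℝ)) s k < 0) ∨
        ((w : (Fin 4 → ℝ) ≃ₗ[ℝ] (Fin 4 → ℝ)) s i < 0 ∧ (w : (Fin 4 → ℝ) ≃ₗ[ℝ] (Fin 4 → ℝ)) s j < 0 ∧
          (w : (Fin 4 → ℝ) ≃ₗ[ℝ] (Fin 4 → ℝ)) s k = 0)) := by
  have hev : ∀ᶠ ε : ℝ in nhds 0, s + ε • (fun _ => (1 : ℝ)) ∉ closure setA := by
    have hc : Continuous fun ε : ℝ => s + ε • (fun _ : Fin 4 => (1 : ℝ)) := by fun_prop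
    exact hc.continuousAt.eventually_mem
      (isClosed_closure.isOpen_compl.mem_nhds (by simpa using hs))
  obtain ⟨δ, hδ, hball⟩ := Metric.eventually_nhds_iff.1 hev
  have hε : s + (δ / 2) • (fun _ => (1 : ℝ)) ∉ setA := fun h =>
    hball (y := δ / 2) (by rw [Real.dist_eq, sub_zero, abs_of_pos] <;> linarith) (subset_closure h)
  obtain ⟨n, hn⟩ := exists_nat_gt (ht s / (4 * (δ / 2)))
  rw [div_lt_iff₀ (by linarith)] at hn
  obtain ⟨w, hw, ⟨e, -, -, -, -, k, hk⟩, hh⟩ := walk (δ / 2) (by linarith) s hε hht n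
  obtain ⟨v, hv, hP⟩ := PP_of_ht (w s) k hk (by linarith)
  exact ⟨v * w, apWstar.mul_mem hv hw, hP⟩
end
end
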